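/- Let G be a Gamma-distributed random variable with shape 1/ν and rate 1/ν (ν > 0), let W be a standard Gaussian random variable independent of G, and let μ, θ ∈ ℝ, σ > 0. Then for every u ∈ ℝ, the characteristic function of X = μ + θG + σ√G·W is E[exp(iuX)] = exp(iuμ) · (1 − iuθν + σ²νu²/2)^{−1/ν}. -/

import Mathlib

open MeasureTheory ProbabilityTheory

lemma vg_integral_gamma {a r : ℝ} (ha : 0 < a) (hr : 0 < r) {f : ℝ → ℝ} :
    ∫ x, f x ∂(gammaMeasure a r) = ∫ x in Set.Ioi 0,
      (r ^ a / (Real.Gamma a) * x ^ (a - 1) * Real.exp (-(r * x))) * f x := by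
  rw [gammaMeasure]
  have h1 : gammaPDF a r = fun x => ENNReal.ofReal (gammaPDFReal a r x) := rfl
  rw [h1, integral_withDensity_eq_integral_toReal_smul (by fun_prop) (by simp)]
  rw [← integral_Ici_eq_integral_Ioi, ← integral_indicator measurableSet_Ici]
  congr 1
  ext x
  rw [ENNReal.toReal_ofReal (gammaPDFReal_nonneg ha hr x)]
  by_cases hx : 0 ≤ x
  · simp [gammaPDFReal, hx]
  · simp [gammaPDFReal, hx]

lemma vg_mgf {a r : ℝ} (ha : 0 < a) (hr : 0 < r) {t : ℝ} (ht : t < r) :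
    mgf id (gammaMeasure a r) t = (1 - t / r) ^ (-a) := by
  have hrt : 0 < r - t := by linarith
  rw [mgf, vg_integral_gamma ha hr]
  have : ∀ x : ℝ, (r ^ a / (Real.Gamma a) * x ^ (a - 1) * Real.exp (-(r * x))) *
      Real.exp (t * id x) =
      r ^ a / (Real.Gamma a) * (x ^ (a - 1) * Real.exp (-((r - t) * x))) := by
    intro x
    rw [mul_assoc, ← Real.exp_add, mul_assoc]
    congr 3
    simp only [id]; ring
  simp_rw [this]
  rw [integral_const_mul, Real.integral_rpow_mul_exp_neg_mul_Ioi ha hrt]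
  have hG := (Real.Gamma_pos_of_pos ha).ne'
  have e : 1 - t / r = (r - t) / r := by field_simp
  rw [e, Real.rpow_neg (by positivity), Real.div_rpow hrt.le hr.le,
    Real.div_rpow zero_le_one hrt.le, Real.one_rpow]
  have := (Real.rpow_pos_of_pos hr a).ne'
  have := (Real.rpow_pos_of_pos hrt a).ne'
  field_simp

lemma vg_complexMGF {a r : ℝ} (ha : 0 < a) (hr : 0 < r) {z : ℂ} (hz : z.re < r) :
    complexMGF id (gammaMeasure a r) z = (1 - z / r) ^ (-(a : ℂ)) := by
  have hpos : ∀ t : ℝ, t < r → 0 < 1 - t / r := by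
    intro t ht
    have : t / r < 1 := (div_lt_one hr).2 ht
    linarith
  have hsub : Set.Iio r ⊆ interior (integrableExpSet id (gammaMeasure a r)) := by
    apply interior_maximal _ isOpen_Iio
    intro t ht
    by_contra h
    have h0 := mgf_undef h
    rw [vg_mgf ha hr ht] at h0
    exact (Real.rpow_pos_of_pos (hpos t ht) _).ne' h0
  have hA : AnalyticOnNhd ℂ (complexMGF id (gammaMeasure a r)) {z : ℂ | z.re < r} :=
    fun w hw => analyticAt_complexMGF (hsub hw)
  have hopen : IsOpen {z : ℂ | z.re < r} := isOpen_lt Complex.continuous_re continuous_const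
  have hB : AnalyticOnNhd ℂ (fun z : ℂ => (1 - z / r) ^ (-(a : ℂ))) {z : ℂ | z.re < r} := by
    apply DifferentiableOn.analyticOnNhd _ hopen
    intro w hw
    apply DifferentiableAt.differentiableWithinAt
    apply DifferentiableAt.cpow (by fun_prop) (by fun_prop)
    left
    have := hpos w.re hw
    simpa [Complex.div_ofReal_re] using this
  refine hA.eqOn_of_preconnected_of_frequently_eq hB
    (convex_halfSpace_re_lt r).isPreconnected (z₀ := 0) (by simpa using hr) ?_ hz
  have hT : Filter.Tendsto (fun t : ℝ => (t : ℂ)) (nhdsWithin 0 {0}ᶜ) (nhdsWithin 0 {0}ᶜ) := by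
    apply tendsto_nhdsWithin_of_tendsto_nhds_of_eventually_within
    · have := (Complex.continuous_ofReal.tendsto 0).mono_left
        (nhdsWithin_le_nhds (s := {0}ᶜ))
      simpa using this
    · filter_upwards [self_mem_nhdsWithin] with t ht
      simpa using ht
  apply hT.frequently
  apply Filter.Eventually.frequently
  filter_upwards [nhdsWithin_le_nhds (Iio_mem_nhds hr)] with t ht
  rw [complexMGF_ofReal, vg_mgf ha hr ht, Complex.ofReal_cpow (hpos t ht).le]
  push_cast
  rfl

lemma vg_ae_nonneg (a r : ℝ) : ∀ᵐ x ∂(gammaMeasure a r), 0 ≤ x := by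
  rw [ae_iff]
  have : {x : ℝ | ¬ 0 ≤ x} = Set.Iio 0 := by ext; simp
  rw [this, gammaMeasure, withDensity_apply _ measurableSet_Iio]
  exact lintegral_gammaPDF_of_nonpos le_rfl

/-- **Characteristic function of the Variance Gamma sampler.** If `G ∼ Gamma(1/ν, 1/ν)`
and `W ∼ N(0,1)` are independent, `σ > 0`, and `X = m + θ G + σ √G W`, then
`E[exp(i u X)] = exp(i u m) (1 - i u θ ν + σ² ν u² / 2)^(-1/ν)` for every `u ∈ ℝ`. -/
theorem variance_gamma_charFun
    {Ω : Type*} [MeasurableSpace Ω] (P : Measure Ω) [IsProbabilityMeasure P]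
    (G W : Ω → ℝ) (hG : Measurable G) (hW : Measurable W)
    (ν : ℝ) (hν : 0 < ν)
    (hGlaw : P.map G = gammaMeasure (1 / ν) (1 / ν))
    (hWlaw : P.map W = gaussianReal 0 1)
    (hindep : IndepFun G W P)
    (m θ σ : ℝ) (hσ : 0 < σ) :
    ∀ u : ℝ,
      (∫ ω, Complex.exp (Complex.I * (u : ℂ) *
          ((m + θ * G ω + σ * Real.sqrt (G ω) * W ω : ℝ) : ℂ)) ∂P)
        = Complex.exp (Complex.I * (u : ℂ) * (m : ℂ)) *
          ((1 : ℂ) - Complex.I * (u : ℂ) * (θ : ℂ) * (ν : ℂ)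
              + (σ : ℂ) ^ 2 * (ν : ℂ) * (u : ℂ) ^ 2 / 2) ^ (-(1 / ν) : ℂ) := by
  intro u
  have hν' : 0 < 1 / ν := by positivity
  have hmap : P.map (fun ω => (G ω, W ω)) =
      (gammaMeasure (1 / ν) (1 / ν)).prod (gaussianReal 0 1) := by
    rw [(indepFun_iff_map_prod_eq_prod_map_map hG.aemeasurable hW.aemeasurable).1 hindep,
      hGlaw, hWlaw]
  have : IsProbabilityMeasure (gammaMeasure (1 / ν) (1 / ν)) :=
    isProbabilityMeasure_gammaMeasure hν' hν'
  let F : ℝ × ℝ → ℂ := fun p => Complex.exp (Complex.I * (u : ℂ) *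
          ((m + θ * p.1 + σ * Real.sqrt p.1 * p.2 : ℝ) : ℂ))
  have hF : Measurable F := by fun_prop
  have hFint : Integrable F ((gammaMeasure (1 / ν) (1 / ν)).prod (gaussianReal 0 1)) := by
    refine Integrable.of_bound hF.aestronglyMeasurable 1 (Filter.Eventually.of_forall fun p => ?_)
    simp only [F]
    rw [Complex.norm_exp]
    simp
  have h1 : (∫ ω, Complex.exp (Complex.I * (u : ℂ) *
          ((m + θ * G ω + σ * Real.sqrt (G ω) * W ω : ℝ) : ℂ)) ∂P) =
      ∫ p, F p ∂((gammaMeasure (1 / ν) (1 / ν)).prod (gaussianReal 0 1)) := by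
    rw [← hmap, integral_map (hG.prodMk hW).aemeasurable hF.aestronglyMeasurable]
  rw [h1, integral_prod F hFint]
  set z : ℂ := Complex.I * u * θ - (σ : ℂ) ^ 2 * (u : ℂ) ^ 2 / 2 with hz
  have h2 : ∀ᵐ x ∂(gammaMeasure (1 / ν) (1 / ν)), ∫ y, F (x, y) ∂(gaussianReal 0 1) =
      Complex.exp (Complex.I * u * m) * Complex.exp (z * x) := by
    filter_upwards [vg_ae_nonneg (1 / ν) (1 / ν)] with x hx
    have e : ∀ y : ℝ, F (x, y) = Complex.exp (Complex.I * u * (m + θ * x)) *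
        Complex.exp (((u * σ * Real.sqrt x : ℝ) : ℂ) * y * Complex.I) := by
      intro y
      simp only [F]
      rw [← Complex.exp_add]
      congr 1
      push_cast
      ring
    simp_rw [e]
    rw [integral_const_mul, ← charFun_apply_real, charFun_gaussianReal, ← Complex.exp_add,
      ← Complex.exp_add]
    congr 1
    have hs : ((Real.sqrt x : ℝ) : ℂ) ^ 2 = x := by
      rw [← Complex.ofReal_pow, Real.sq_sqrt hx]
    push_cast
    rw [mul_pow, hs, hz]
    ring
  rw [integral_congr_ae h2, integral_const_mul]
  congr 1
  have hre : z.re < 1 / ν := by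
    have : z.re = -(σ ^ 2 * u ^ 2 / 2) := by
      have : z = ((-(σ ^ 2 * u ^ 2 / 2) : ℝ) : ℂ) + ((u * θ : ℝ) : ℂ) * Complex.I := by
        rw [hz]; push_cast; ring
      rw [this]
      simp [-Complex.ofReal_mul, -Complex.ofReal_neg, -Complex.ofReal_div]
    rw [this]
    have : 0 ≤ σ ^ 2 * u ^ 2 / 2 := by positivity
    linarith
  have h3 := vg_complexMGF hν' hν' hre
  rw [complexMGF] at h3
  simp only [id] at h3
  rw [h3]
  have hνc : (ν : ℂ) ≠ 0 := by exact_mod_cast hν.ne'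
  congr 1
  · rw [hz]; push_cast; field_simp; ring
  · push_cast; rfl
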